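/- Let V be a C_2-cofinite vertex operator algebra of CFT-type. Then the following are equivalent: (1) every weak V-module is a direct sum of irreducible ordinary V-modules (regularity); (2) every ℕ-gradable weak V-module is a direct sum of irreducible ℕ-gradable weak modules (rationality). -/

import Mathlib

open scoped BigOperators

namespace VOAPaper

/-- Integer binomial coefficient `C(m, i)` for `m : ℤ`, `i : ℕ`. -/
def zchoose (m : ℤ) (i : ℕ) : ℤ :=
  if 0 ≤ m then ((m.toNat).choose i : ℤ)
  else (-1) ^ i * ((((i : ℤ) - m - 1).toNat).choose i : ℤ)

variable (V : Type) [AddCommGroup V] [Module ℂ V]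

/-- A vertex algebra structure on `V`: modes `u_n`, vacuum, truncation,
vacuum/creation axioms, and the Borcherds (Jacobi) identity. -/
structure VertexAlg where
  mode : V →ₗ[ℂ] ℤ → Module.End ℂ V
  vac : V
  trunc : ∀ u w : V, ∃ N : ℤ, ∀ n : ℤ, N ≤ n → mode u n w = 0
  vac_mode : ∀ (n : ℤ) (w : V), mode vac n w = if n = -1 then w else 0
  creation_neg_one : ∀ u : V, mode u (-1) vac = u
  creation_nonneg : ∀ (u : V) (n : ℤ), 0 ≤ n → mode u n vac = 0
  borcherds : ∀ (u v w : V) (p q m : ℤ),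
    (∑ᶠ i : ℕ, zchoose m i • mode (mode u (p + i) v) (m + q - i) w) =
    (∑ᶠ i : ℕ, ((-1 : ℤ) ^ i * zchoose p i) •
      (mode u (p + m - i) (mode v (q + i) w)
        - (p.negOnePow : ℤ) • mode v (p + q - i) (mode u (m + i) w)))

/-- A vertex operator algebra of CFT-type: a vertex algebra with conformal
vector `ω`, central charge `c`, an `L(0)`-grading `V = ⊕_{n ≥ 0} V_n` with
`V_0 = ℂ 1`, Virasoro relations, and the `L(-1)`-derivation property. -/
structure VOA extends VertexAlg V where
  ω : V
  c : ℂ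
  grading : ℤ → Submodule ℂ V
  internal : DirectSum.IsInternal grading
  neg_bot : ∀ n : ℤ, n < 0 → grading n = ⊥
  L0_eigen : ∀ (n : ℤ) (v : V), v ∈ grading n → mode ω 1 v = (n : ℂ) • v
  vac_grade : vac ∈ grading 0
  cft : grading 0 = Submodule.span ℂ {vac}
  ω_grade : ω ∈ grading 2
  virasoro : ∀ m n : ℤ,
    mode ω (m + 1) * mode ω (n + 1) - mode ω (n + 1) * mode ω (m + 1)
      = (m - n) • mode ω (m + n + 1)
        + (if m + n = 0 then ((m ^ 3 - m : ℂ) / 12) * c else 0) • (1 : Module.End ℂ V)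
  Lneg1_deriv : ∀ (u : V) (n : ℤ), mode (mode ω 0 u) n = (-n) • mode u (n - 1)

/-- A weak module for (the underlying vertex algebra of) `V`. -/
structure WeakMod (A : VertexAlg V) (M : Type) [AddCommGroup M] [Module ℂ M] where
  mmode : V →ₗ[ℂ] ℤ → Module.End ℂ M
  trunc : ∀ (v : V) (w : M), ∃ N : ℤ, ∀ n : ℤ, N ≤ n → mmode v n w = 0
  vac_mode : ∀ (n : ℤ) (w : M), mmode A.vac n w = if n = -1 then w else 0
  borcherds : ∀ (u v : V) (w : M) (p q m : ℤ),
    (∑ᶠ i : ℕ, zchoose m i • mmode (A.mode u (p + i) v) (m + q - i) w) =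
    (∑ᶠ i : ℕ, ((-1 : ℤ) ^ i * zchoose p i) •
      (mmode u (p + m - i) (mmode v (q + i) w)
        - (p.negOnePow : ℤ) • mmode v (p + q - i) (mmode u (m + i) w)))

/-- An ℕ-gradable weak module: a weak module with a compatible
lower-truncated grading `M = ⊕_{n ≥ 0} M(n)`. -/
structure NGradedMod (W : VOA V) (M : Type) [AddCommGroup M] [Module ℂ M]
    extends WeakMod V W.toVertexAlg M where
  mgrading : ℤ → Submodule ℂ M
  internal : DirectSum.IsInternal mgrading
  neg_bot : ∀ n : ℤ, n < 0 → mgrading n = ⊥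
  compat : ∀ (r : ℤ) (v : V), v ∈ W.grading r → ∀ (m n : ℤ), ∀ w ∈ mgrading n,
    mmode v m w ∈ mgrading (n + r - m - 1)

/-- Iterated application of modes: `applyModes [(u¹,n₁),…,(uʳ,nᵣ)] w = u¹_{n₁} ⋯ uʳ_{nᵣ} w`. -/
def applyModes (A : VertexAlg V) : List (V × ℤ) → V → V
  | [], w => w
  | p :: L, w => A.mode p.1 p.2 (applyModes A L w)

/-- Iterated application of module modes. -/
def applyModesM {M : Type} [AddCommGroup M] [Module ℂ M] {A : VertexAlg V}
    (Mod : WeakMod V A M) : List (V × ℤ) → M → M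
  | [], w => w
  | p :: L, w => Mod.mmode p.1 p.2 (applyModesM Mod L w)

/-- The subspace `C_n(V) = span{ u_{-n} v }`. -/
def Cspace (A : VertexAlg V) (n : ℕ) : Submodule ℂ V :=
  Submodule.span ℂ { x | ∃ u v : V, x = A.mode u (-(n : ℤ)) v }

/-- The subspace `C_1(V) = span{ u_{-1} v, L(-1)u : u, v ∈ V_+ }`. -/
def C1space (W : VOA V) : Submodule ℂ V :=
  Submodule.span ℂ
    ({ x | ∃ u v : V, (∃ r : ℤ, 0 < r ∧ u ∈ W.grading r) ∧
        (∃ r : ℤ, 0 < r ∧ v ∈ W.grading r) ∧ x = W.mode u (-1) v }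
      ∪ { x | ∃ u : V, (∃ r : ℤ, 0 < r ∧ u ∈ W.grading r) ∧ x = W.mode W.ω 0 u })

/-- A submodule invariant under all modes. -/
def Invariant {M : Type} [AddCommGroup M] [Module ℂ M] {A : VertexAlg V}
    (Mod : WeakMod V A M) (N : Submodule ℂ M) : Prop :=
  ∀ (v : V) (n : ℤ), ∀ w ∈ N, Mod.mmode v n w ∈ N

/-- Irreducibility of a weak module. -/
def IsIrreducibleMod {M : Type} [AddCommGroup M] [Module ℂ M] {A : VertexAlg V}
    (Mod : WeakMod V A M) : Prop :=
  (⊤ : Submodule ℂ M) ≠ ⊥ ∧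
    ∀ N : Submodule ℂ M, Invariant V Mod N → N = ⊥ ∨ N = ⊤

/-- An invariant submodule which is an irreducible ordinary `V`-module:
nonzero, simple among invariant submodules, exhausted by its `L(0)`-eigenspaces,
with finite-dimensional and lower-truncated graded pieces. -/
def IsSimpleOrdinarySub (W : VOA V) {M : Type} [AddCommGroup M] [Module ℂ M]
    (Mod : WeakMod V W.toVertexAlg M) (N : Submodule ℂ M) : Prop :=
  Invariant V Mod N ∧ N ≠ ⊥ ∧
  (∀ P : Submodule ℂ M, P ≤ N → Invariant V Mod P → P = ⊥ ∨ P = N) ∧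
  (⨆ μ : ℂ, Module.End.eigenspace (Mod.mmode W.ω 1) μ ⊓ N) = N ∧
  (∀ μ : ℂ, FiniteDimensional ℂ
      (Module.End.eigenspace (Mod.mmode W.ω 1) μ ⊓ N : Submodule ℂ M)) ∧
  (∀ μ : ℂ, ∃ Nb : ℤ, ∀ n : ℤ, n ≤ Nb →
      Module.End.eigenspace (Mod.mmode W.ω 1) (μ + n) ⊓ N = ⊥)

/-- An invariant submodule which is an irreducible ℕ-gradable weak module. -/
def IsSimpleGradableSub (W : VOA V) {M : Type} [AddCommGroup M] [Module ℂ M]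
    (Mod : WeakMod V W.toVertexAlg M) (N : Submodule ℂ M) : Prop :=
  Invariant V Mod N ∧ N ≠ ⊥ ∧
  (∀ P : Submodule ℂ M, P ≤ N → Invariant V Mod P → P = ⊥ ∨ P = N) ∧
  ∃ g : ℤ → Submodule ℂ M, (∀ n : ℤ, g n ≤ N) ∧ (∀ n : ℤ, n < 0 → g n = ⊥) ∧
    iSupIndep g ∧ (⨆ n : ℤ, g n) = N ∧
    (∀ (r : ℤ) (v : V), v ∈ W.grading r → ∀ (m n : ℤ), ∀ w ∈ g n,
      Mod.mmode v m w ∈ g (n + r - m - 1))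

/-- A weak module admitting a compatible ℕ-grading. -/
def IsNGradable (W : VOA V) {M : Type} [AddCommGroup M] [Module ℂ M]
    (Mod : WeakMod V W.toVertexAlg M) : Prop :=
  ∃ g : ℤ → Submodule ℂ M, DirectSum.IsInternal g ∧ (∀ n : ℤ, n < 0 → g n = ⊥) ∧
    ∀ (r : ℤ) (v : V), v ∈ W.grading r → ∀ (m n : ℤ), ∀ w ∈ g n,
      Mod.mmode v m w ∈ g (n + r - m - 1)

section Helpers

variable {V}

lemma zchoose_zero_right (m : ℤ) : zchoose m 0 = 1 := by
  unfold zchoose; split_ifs <;> simp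

lemma zchoose_zero_left {i : ℕ} (hi : i ≠ 0) : zchoose 0 i = 0 := by
  simp [zchoose, Nat.choose_eq_zero_of_lt (Nat.pos_of_ne_zero hi)]

lemma zchoose_one_one : zchoose 1 1 = 1 := by simp [zchoose]

lemma zchoose_one_left {i : ℕ} (hi : 2 ≤ i) : zchoose 1 i = 0 := by
  simp [zchoose, Nat.choose_eq_zero_of_lt hi]

lemma zchoose_neg_one (i : ℕ) : zchoose (-1) i = (-1) ^ i := by
  simp [zchoose]

lemma zchoose_neg_two (i : ℕ) : zchoose (-2) i = (-1) ^ i * (i + 1) := by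
  have h : ((i : ℤ) - -2 - 1).toNat = i + 1 := by omega
  rw [zchoose, if_neg (by decide), h, Nat.choose_succ_self_right]
  push_cast; rfl

lemma finsum_mem_submodule {M ι : Type*} [AddCommGroup M] [Module ℂ M] (S : Submodule ℂ M)
    {f : ι → M} (hf : ∀ i, f i ∈ S) : ∑ᶠ i, f i ∈ S :=
  finsum_induction (fun x => x ∈ S) S.zero_mem (fun _ _ => S.add_mem) hf

/-- A family of submodules dominated by an independent family with the same supremum equals it. -/
lemma eq_of_le_of_iSupIndep {M ι : Type*} [AddCommGroup M] [Module ℂ M]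
    {s t : ι → Submodule ℂ M} (ht : iSupIndep t) (hst : ∀ i, s i ≤ t i)
    (hsup : ⨆ i, t i ≤ ⨆ i, s i) (i : ι) : s i = t i := by
  refine le_antisymm (hst i) fun x hx => ?_
  have h1 : x ∈ s i ⊔ ⨆ (j) (_ : j ≠ i), t j := by
    have h2 : ⨆ i, s i ≤ s i ⊔ ⨆ (j) (_ : j ≠ i), t j := by
      refine iSup_le fun j => ?_
      by_cases hj : j = i
      · subst hj; exact le_sup_left
      · exact ((hst j).trans (le_iSup₂_of_le j hj le_rfl)).trans le_sup_right
    exact h2 (hsup (le_iSup t i hx))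
  obtain ⟨y, hy, z, hz, rfl⟩ := Submodule.mem_sup.1 h1
  have hz' : z ∈ t i := by
    have := (t i).sub_mem hx (hst i hy)
    simpa using this
  have : z = 0 := by
    have := (Submodule.disjoint_def.1 (ht i)) z hz' hz
    exact this
  simpa [this] using hy

namespace WeakMod

variable {A : VertexAlg V} {M : Type} [AddCommGroup M] [Module ℂ M] (Mod : WeakMod V A M)

lemma commutator (u v : V) (w : M) (m q : ℤ) :
    Mod.mmode u m (Mod.mmode v q w) - Mod.mmode v q (Mod.mmode u m w) =
      ∑ᶠ i : ℕ, zchoose m i • Mod.mmode (A.mode u i v) (m + q - i) w := by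
  have h := Mod.borcherds u v w 0 q m
  rw [finsum_eq_single (fun i : ℕ => ((-1 : ℤ) ^ i * zchoose 0 i) • _) 0 (by
    intro i hi; rw [zchoose_zero_left hi]; simp)] at h
  simpa [zchoose_zero_right] using h.symm

lemma iterate (u v : V) (w : M) (p q : ℤ) :
    Mod.mmode (A.mode u p v) q w = ∑ᶠ i : ℕ, ((-1 : ℤ) ^ i * zchoose p i) •
      (Mod.mmode u (p - i) (Mod.mmode v (q + i) w)
        - (p.negOnePow : ℤ) • Mod.mmode v (p + q - i) (Mod.mmode u i w)) := by
  have h := Mod.borcherds u v w p q 0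
  rw [finsum_eq_single (a := 0) _ (by
    intro i hi; rw [zchoose_zero_left hi]; simp)] at h
  simpa [zchoose_zero_right] using h

lemma mmode_neg_two_vac (u : V) (n : ℤ) (w : M) :
    Mod.mmode (A.mode u (-2) A.vac) n w = (-n) • Mod.mmode u (n - 1) w := by
  rw [Mod.iterate]
  have key : ∀ i : ℕ, ((-1 : ℤ) ^ i * zchoose (-2) i) = i + 1 := by
    intro i
    rw [zchoose_neg_two, ← mul_assoc, ← mul_pow]; simp
  simp only [key, Mod.vac_mode]
  have h2 : ((-2 : ℤ).negOnePow : ℤ) = 1 := by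
    rw [Int.negOnePow_even _ (by decide)]; rfl
  rw [h2]
  rcases lt_trichotomy n 0 with hn | rfl | hn
  · rw [finsum_eq_single (a := (-1 - n).toNat)]
    · have e : (((-1 - n).toNat : ℕ) : ℤ) = -1 - n := by omega
      rw [e, if_pos (by ring), if_neg (by omega)]
      simp only [smul_zero, sub_zero]
      rw [show -2 - (-1 - n) = n - 1 by ring,
        show -1 - n + 1 = -n by ring]
    · intro i hi
      rw [if_neg (by omega), if_neg (by omega)]; simp
  · rw [finsum_eq_zero_of_forall_eq_zero]
    · simp
    · intro i
      rw [if_neg (by omega), if_neg (by omega)]; simp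
  · rw [finsum_eq_single (a := (n - 1).toNat)]
    · have e : (((n - 1).toNat : ℕ) : ℤ) = n - 1 := by omega
      rw [e, if_neg (by omega), if_pos (by ring)]
      simp
    · intro i hi
      rw [if_neg (by omega), if_neg (by omega)]; simp

end WeakMod

/-- A vertex algebra as a weak module over itself. -/
def VertexAlg.self (A : VertexAlg V) : WeakMod V A V where
  mmode := A.mode
  trunc := A.trunc
  vac_mode := A.vac_mode
  borcherds := A.borcherds

namespace VOA

variable (W : VOA V)

lemma omega_zero (u : V) : W.mode W.ω 0 u = W.mode u (-2) W.vac := by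
  have h := congrArg (fun f => f W.vac) (W.Lneg1_deriv u (-1))
  simpa [W.creation_neg_one] using h

section

variable {M : Type} [AddCommGroup M] [Module ℂ M] (Mod : WeakMod V W.toVertexAlg M)

lemma L0_mmode {r : ℤ} {v : V} (hv : v ∈ W.grading r) (n : ℤ) (w : M) :
    Mod.mmode W.ω 1 (Mod.mmode v n w) =
      Mod.mmode v n (Mod.mmode W.ω 1 w) + ((r - n - 1 : ℤ) : ℂ) • Mod.mmode v n w := by
  have h := Mod.commutator W.ω v w 1 n
  rw [finsum_eq_sum_of_support_subset (s := Finset.range 2)] at h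
  · rw [Finset.sum_range_succ, Finset.sum_range_one, zchoose_zero_right, zchoose_one_one] at h
    simp only [Nat.cast_zero, Nat.cast_one, one_smul, sub_zero] at h
    rw [W.L0_eigen r v hv, W.omega_zero, Mod.mmode_neg_two_vac] at h
    rw [sub_eq_iff_eq_add'] at h
    rw [h, map_smul]
    simp only [Pi.smul_apply, LinearMap.smul_apply]
    rw [show (1 : ℤ) + n - 1 = n by ring, ← Int.cast_smul_eq_zsmul ℂ, ← add_smul]
    congr 2
    push_cast; ring
  · intro i hi
    simp only [Finset.coe_range, Set.mem_Iio]
    by_contra hlt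
    exact hi (by simp [zchoose_one_left (not_lt.1 hlt)])

lemma mmode_mem_eigenspace {r : ℤ} {v : V} (hv : v ∈ W.grading r) (n : ℤ) {w : M} {μ : ℂ}
    (hw : w ∈ Module.End.eigenspace (Mod.mmode W.ω 1) μ) :
    Mod.mmode v n w ∈
      Module.End.eigenspace (Mod.mmode W.ω 1) (μ + ((r - n - 1 : ℤ) : ℂ)) := by
  rw [Module.End.mem_eigenspace_iff] at hw ⊢
  rw [W.L0_mmode Mod hv, hw, map_smul, add_smul]

lemma mmode_mem_maxGenEigenspace {r : ℤ} {v : V} (hv : v ∈ W.grading r) (n : ℤ) {w : M} {μ : ℂ}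
    (hw : w ∈ Module.End.maxGenEigenspace (Mod.mmode W.ω 1) μ) :
    Mod.mmode v n w ∈
      Module.End.maxGenEigenspace (Mod.mmode W.ω 1) (μ + ((r - n - 1 : ℤ) : ℂ)) := by
  rw [Module.End.mem_maxGenEigenspace] at hw ⊢
  obtain ⟨k, hk⟩ := hw
  refine ⟨k, ?_⟩
  have hc : SemiconjBy (Mod.mmode v n) (Mod.mmode W.ω 1 - μ • 1)
      (Mod.mmode W.ω 1 - (μ + ((r - n - 1 : ℤ) : ℂ)) • 1) := by
    ext x
    simp only [Module.End.mul_apply, LinearMap.sub_apply, LinearMap.smul_apply,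
      Module.End.one_apply, map_sub, map_smul, W.L0_mmode Mod hv]
    module
  have h := congrArg (fun f => f w) (hc.pow_right k)
  simp only [Module.End.mul_apply] at h
  rw [← h, hk, map_zero]

end

lemma iSupIndep_eigenspace_int {M : Type} [AddCommGroup M] [Module ℂ M] (f : Module.End ℂ M)
    (μ : ℂ) : iSupIndep fun n : ℤ => f.eigenspace (μ + n) :=
  (Module.End.eigenspaces_iSupIndep f).comp (f := fun n : ℤ => μ + (n : ℂ))
    fun a b hab => by simpa using hab

lemma grading_eq_eigenspace (n : ℤ) :
    W.grading n = Module.End.eigenspace (W.mode W.ω 1) (n : ℂ) := by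
  have hi := iSupIndep_eigenspace_int (W.mode W.ω 1) 0
  simp only [zero_add] at hi
  refine eq_of_le_of_iSupIndep hi (fun i v hv => ?_) ?_ n
  · exact Module.End.mem_eigenspace_iff.2 (W.L0_eigen i v hv)
  · rw [W.internal.submodule_iSup_eq_top]; exact le_top

lemma mode_mem_grading {r s : ℤ} {u v : V} (hu : u ∈ W.grading r) (hv : v ∈ W.grading s) (n : ℤ) :
    W.mode u n v ∈ W.grading (r + s - n - 1) := by
  rw [grading_eq_eigenspace] at hv ⊢
  have h := W.mmode_mem_eigenspace W.self hu n hv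
  rw [show ((r + s - n - 1 : ℤ) : ℂ) = s + ((r - n - 1 : ℤ) : ℂ) by push_cast; ring]
  exact h

end VOA

lemma exists_perm_of_not_nodup_map {α β : Type*} (f : α → β) :
    ∀ L : List α, ¬ (L.map f).Nodup → ∃ a b L', L.Perm (a :: b :: L') ∧ f a = f b
  | [], h => absurd List.nodup_nil h
  | x :: L, h => by
    by_cases hx : f x ∈ L.map f
    · obtain ⟨b, hb, hbx⟩ := List.mem_map.1 hx
      obtain ⟨s, t, rfl⟩ := List.append_of_mem hb
      exact ⟨x, b, s ++ t, List.Perm.cons _ List.perm_middle, hbx.symm⟩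
    · have hL : ¬ (L.map f).Nodup := fun hn => h (by
        rw [List.map_cons]; exact List.nodup_cons.2 ⟨hx, hn⟩)
      obtain ⟨a, b, L', hp, hab⟩ := exists_perm_of_not_nodup_map f L hL
      exact ⟨a, b, x :: L', (hp.cons x).trans
        ((List.Perm.swap a x _).trans ((List.Perm.swap b x _).cons a)), hab⟩

lemma List.sum_sq_le_sq_sum {α : Type*} (f : α → ℤ) :
    ∀ L : List α, (∀ a ∈ L, 0 ≤ f a) →
      0 ≤ (L.map f).sum ∧ (L.map fun a => f a ^ 2).sum ≤ (L.map f).sum ^ 2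
  | [], _ => by simp
  | a :: L, h => by
    have ⟨h1, h2⟩ := List.sum_sq_le_sq_sum f L fun b hb => h b (List.mem_cons_of_mem _ hb)
    have h3 := h a List.mem_cons_self
    simp only [List.map_cons, List.sum_cons]
    exact ⟨by positivity, by nlinarith⟩

/-- The total weight of the vectors of a word; a letter `((r, v), n)` stands for the mode `v_n`
of a vector `v` of weight `r`. -/
def wordWt {X : Type} (L : List ((ℕ × X) × ℤ)) : ℕ := (L.map fun a => a.1.1).sum

/-- The degree by which a word shifts gradings. -/
def wordDeg {X : Type} (L : List ((ℕ × X) × ℤ)) : ℤ := (L.map fun a => (a.1.1 : ℤ) - a.2 - 1).sum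

/-- The operator given by a word. -/
def wordOp {A : VertexAlg V} {M : Type} [AddCommGroup M] [Module ℂ M] (Mod : WeakMod V A M)
    (L : List ((ℕ × V) × ℤ)) : Module.End ℂ M := (L.map fun a => Mod.mmode a.1.2 a.2).prod

/-- Every letter of the word is homogeneous of the recorded weight. -/
def VOA.IsHomWord (W : VOA V) (L : List ((ℕ × V) × ℤ)) : Prop :=
  ∀ a ∈ L, a.1.2 ∈ W.grading a.1.1

section

variable {X : Type}

@[simp] lemma wordWt_nil : wordWt ([] : List ((ℕ × X) × ℤ)) = 0 := rfl
@[simp] lemma wordWt_cons (a : (ℕ × X) × ℤ) (L) : wordWt (a :: L) = a.1.1 + wordWt L := by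
  simp [wordWt]
@[simp] lemma wordWt_append (L L' : List ((ℕ × X) × ℤ)) :
    wordWt (L ++ L') = wordWt L + wordWt L' := by
  simp [wordWt]
@[simp] lemma wordDeg_nil : wordDeg ([] : List ((ℕ × X) × ℤ)) = 0 := rfl
@[simp] lemma wordDeg_cons (a : (ℕ × X) × ℤ) (L) :
    wordDeg (a :: L) = (a.1.1 - a.2 - 1) + wordDeg L := by
  simp [wordDeg]
@[simp] lemma wordDeg_append (L L' : List ((ℕ × X) × ℤ)) :
    wordDeg (L ++ L') = wordDeg L + wordDeg L' := by
  simp [wordDeg]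

lemma wordWt_perm {L L' : List ((ℕ × X) × ℤ)} (h : L.Perm L') : wordWt L = wordWt L' :=
  (h.map _).sum_eq

lemma wordDeg_perm {L L' : List ((ℕ × X) × ℤ)} (h : L.Perm L') : wordDeg L = wordDeg L' :=
  (h.map _).sum_eq

end

section

variable {A : VertexAlg V} {M : Type} [AddCommGroup M] [Module ℂ M] (Mod : WeakMod V A M)

@[simp] lemma wordOp_nil (x : M) : wordOp Mod [] x = x := rfl
@[simp] lemma wordOp_cons (a : (ℕ × V) × ℤ) (L) (x : M) :
    wordOp Mod (a :: L) x = Mod.mmode a.1.2 a.2 (wordOp Mod L x) := by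
  simp [wordOp]
@[simp] lemma wordOp_append (L L' : List ((ℕ × V) × ℤ)) (x : M) :
    wordOp Mod (L ++ L') x = wordOp Mod L (wordOp Mod L' x) := by
  simp [wordOp]

end

namespace VOA

variable {W : VOA V}

lemma isHomWord_append {L L' : List ((ℕ × V) × ℤ)} :
    W.IsHomWord (L ++ L') ↔ W.IsHomWord L ∧ W.IsHomWord L' := by
  simp [IsHomWord, or_imp, forall_and]

lemma isHomWord_cons {a : (ℕ × V) × ℤ} {L : List ((ℕ × V) × ℤ)} :
    W.IsHomWord (a :: L) ↔ a.1.2 ∈ W.grading a.1.1 ∧ W.IsHomWord L := by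
  simp [IsHomWord]

lemma IsHomWord.perm {L L' : List ((ℕ × V) × ℤ)} (h : W.IsHomWord L) (hp : L.Perm L') :
    W.IsHomWord L' := fun a ha => h a (hp.mem_iff.2 ha)

lemma eq_zero_of_mem_grading_neg {r : ℤ} (hr : r < 0) {v : V} (hv : v ∈ W.grading r) : v = 0 := by
  rw [W.neg_bot r hr] at hv; simpa using hv

/-- All words of degree `d` with weight and length lexicographically below `(N, k)`
map `w` into `G`. -/
def LowerWordsIn (W : VOA V) {M : Type} [AddCommGroup M] [Module ℂ M]
    (Mod : WeakMod V W.toVertexAlg M) (w : M) (G : Submodule ℂ M) (N k : ℕ) (d : ℤ) : Prop :=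
  ∀ L, W.IsHomWord L → wordDeg L = d →
    (wordWt L < N ∨ wordWt L = N ∧ L.length < k) → wordOp Mod L w ∈ G

namespace LowerWordsIn

variable {M : Type} [AddCommGroup M] [Module ℂ M] {Mod : WeakMod V W.toVertexAlg M}
  {w : M} {G : Submodule ℂ M} {N k : ℕ} {d : ℤ}

lemma single (hG : W.LowerWordsIn Mod w G N k d) {L₁ L₂ : List ((ℕ × V) × ℤ)}
    (h₁ : W.IsHomWord L₁) (h₂ : W.IsHomWord L₂) {s : ℤ} {x : V} (hx : x ∈ W.grading s) (q : ℤ)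
    (hd : wordDeg L₁ + wordDeg L₂ + (s - q - 1) = d)
    (hN : (wordWt L₁ : ℤ) + wordWt L₂ + s < N ∨
      (wordWt L₁ : ℤ) + wordWt L₂ + s = N ∧ L₁.length + L₂.length + 1 < k) :
    wordOp Mod L₁ (Mod.mmode x q (wordOp Mod L₂ w)) ∈ G := by
  rcases lt_or_ge s 0 with hs | hs
  · simp [eq_zero_of_mem_grading_neg hs hx]
  · lift s to ℕ using hs
    have := hG (L₁ ++ ((s, x), q) :: L₂) (isHomWord_append.2 ⟨h₁, isHomWord_cons.2 ⟨hx, h₂⟩⟩)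
      (by simp only [wordDeg_append, wordDeg_cons]; linarith)
      (by simp only [wordWt_append, wordWt_cons, List.length_append, List.length_cons]; omega)
    simpa using this

lemma pair (hG : W.LowerWordsIn Mod w G N k d) {L₁ L₂ : List ((ℕ × V) × ℤ)}
    (h₁ : W.IsHomWord L₁) (h₂ : W.IsHomWord L₂) {s t : ℤ} {x y : V} (hx : x ∈ W.grading s)
    (hy : y ∈ W.grading t) (p q : ℤ)
    (hd : wordDeg L₁ + wordDeg L₂ + (s - p - 1) + (t - q - 1) = d)
    (hN : (wordWt L₁ : ℤ) + wordWt L₂ + s + t < N) :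
    wordOp Mod L₁ (Mod.mmode x p (Mod.mmode y q (wordOp Mod L₂ w))) ∈ G := by
  rcases lt_or_ge t 0 with ht | ht
  · simp [eq_zero_of_mem_grading_neg ht hy]
  · lift t to ℕ using ht
    have := hG.single h₁ (L₂ := ((t, y), q) :: L₂) (isHomWord_cons.2 ⟨hy, h₂⟩) hx p
      (by simp only [wordDeg_cons]; linarith)
      (by simp only [wordWt_cons]; push_cast; left; linarith)
    simpa using this

lemma swap (hG : W.LowerWordsIn Mod w G N k d) {L₁ L₂ : List ((ℕ × V) × ℤ)}
    {a b : (ℕ × V) × ℤ} (hh : W.IsHomWord (L₁ ++ a :: b :: L₂))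
    (hd : wordDeg (L₁ ++ a :: b :: L₂) = d) (hN : wordWt (L₁ ++ a :: b :: L₂) = N) :
    wordOp Mod (L₁ ++ a :: b :: L₂) w - wordOp Mod (L₁ ++ b :: a :: L₂) w ∈ G := by
  simp only [isHomWord_append, isHomWord_cons] at hh
  obtain ⟨h₁, ha, hb, h₂⟩ := hh
  simp only [wordDeg_append, wordDeg_cons] at hd
  simp only [wordWt_append, wordWt_cons] at hN
  simp only [wordOp_append, wordOp_cons]
  rw [← map_sub, Mod.commutator]
  refine finsum_mem_submodule (G.comap (wordOp Mod L₁)) fun i => zsmul_mem ?_ _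
  exact hG.single h₁ h₂ (W.mode_mem_grading ha hb i) _ (by linarith) (by left; omega)

lemma perm (hG : W.LowerWordsIn Mod w G N k d) {l l' : List ((ℕ × V) × ℤ)} (hp : l.Perm l') :
    ∀ P, W.IsHomWord (P ++ l) → wordDeg (P ++ l) = d → wordWt (P ++ l) = N →
      wordOp Mod (P ++ l) w - wordOp Mod (P ++ l') w ∈ G := by
  induction hp with
  | nil => intro P _ _ _; simp
  | cons x hp ih =>
    intro P h1 h2 h3
    have := ih (P ++ [x]) (by simpa using h1) (by simpa using h2) (by simpa using h3)
    simpa using this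
  | swap x y l => intro P h1 h2 h3; exact hG.swap h1 h2 h3
  | trans hp1 hp2 ih1 ih2 =>
    intro P h1 h2 h3
    have e := hp1.append_left P
    have := G.add_mem (ih1 P h1 h2 h3)
      (ih2 P (h1.perm e) ((wordDeg_perm e).symm.trans h2) ((wordWt_perm e).symm.trans h3))
    simpa using this

lemma mem_of_perm (hG : W.LowerWordsIn Mod w G N k d) {l l' : List ((ℕ × V) × ℤ)}
    (hp : l.Perm l') (hh : W.IsHomWord l) (hd : wordDeg l = d) (hN : wordWt l = N)
    (hl' : wordOp Mod l' w ∈ G) : wordOp Mod l w ∈ G := by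
  have := G.add_mem (hG.perm hp [] hh hd hN) hl'
  simpa using this

lemma mode_neg_two (hG : W.LowerWordsIn Mod w G N k d) {L₁ L₂ : List ((ℕ × V) × ℤ)}
    (h₁ : W.IsHomWord L₁) (h₂ : W.IsHomWord L₂) {s t : ℤ} {x y : V} (hx : x ∈ W.grading s)
    (hy : y ∈ W.grading t) (q : ℤ)
    (hd : wordDeg L₁ + wordDeg L₂ + (s + t + 1 - q - 1) = d)
    (hN : (wordWt L₁ : ℤ) + wordWt L₂ + (s + t + 1) = N) :
    wordOp Mod L₁ (Mod.mmode (W.mode x (-2) y) q (wordOp Mod L₂ w)) ∈ G := by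
  rw [Mod.iterate]
  refine finsum_mem_submodule (G.comap (wordOp Mod L₁)) fun i => zsmul_mem ?_ _
  refine sub_mem ?_ (zsmul_mem ?_ _)
  · exact hG.pair h₁ h₂ hx hy _ _ (by linarith) (by linarith)
  · exact hG.pair h₁ h₂ hy hx _ _ (by linarith) (by linarith)

lemma repeated (hG : W.LowerWordsIn Mod w G N k d) {L : List ((ℕ × V) × ℤ)} {a b : ℕ × V} {n : ℤ}
    (hh : W.IsHomWord ((a, n) :: (b, n) :: L)) (hd : wordDeg ((a, n) :: (b, n) :: L) = d)
    (hN : wordWt ((a, n) :: (b, n) :: L) = N) (hk : ((a, n) :: (b, n) :: L).length = k)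
    (hab : ∀ s t : ℤ, s + t = 2 * n → s ≠ n → wordOp Mod ((a, s) :: (b, t) :: L) w ∈ G)
    (hba : ∀ s t : ℤ, s + t = 2 * n → s ≠ n → wordOp Mod ((b, s) :: (a, t) :: L) w ∈ G) :
    wordOp Mod ((a, n) :: (b, n) :: L) w ∈ G := by
  have hsw : wordOp Mod ((b, n) :: (a, n) :: L) w ∈ G → wordOp Mod ((a, n) :: (b, n) :: L) w ∈ G :=
    hG.mem_of_perm (List.Perm.swap _ _ _) hh hd hN
  simp only [isHomWord_cons] at hh
  obtain ⟨ha, hb, hL⟩ := hh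
  simp only [wordDeg_cons] at hd
  simp only [wordWt_cons] at hN
  simp only [List.length_cons] at hk
  simp only [wordOp_cons] at hab hba hsw ⊢
  set X := wordOp Mod L w
  have hlow : Mod.mmode (W.mode a.2 (-1) b.2) (2 * n + 1) X ∈ G :=
    hG.single (L₁ := []) (by simp [IsHomWord]) hL (W.mode_mem_grading ha hb (-1)) _
      (by simp; linarith) (by simp; right; omega)
  have hit := Mod.iterate a.2 b.2 X (-1) (2 * n + 1)
  have key : ∀ i : ℕ, ((-1 : ℤ) ^ i * zchoose (-1) i) = 1 := by
    intro i
    rw [zchoose_neg_one, ← mul_pow]; simp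
  have h1 : ((-1 : ℤ).negOnePow : ℤ) = -1 := by
    rw [Int.negOnePow_odd _ (by decide)]; rfl
  simp only [key, h1, one_smul, neg_smul, sub_neg_eq_add] at hit
  set f : ℕ → M := fun i => Mod.mmode a.2 (-1 - i) (Mod.mmode b.2 (2 * n + 1 + i) X) +
    Mod.mmode b.2 (-1 + (2 * n + 1) - i) (Mod.mmode a.2 i X) with hf
  have hfin : (Function.support f).Finite := by
    obtain ⟨N₁, hN₁⟩ := Mod.trunc a.2 X
    obtain ⟨N₂, hN₂⟩ := Mod.trunc b.2 X
    refine (Set.finite_Iio (N₁.toNat + (N₂ - (2 * n + 1)).toNat)).subset fun i hi => ?_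
    by_contra hlt
    simp only [Set.mem_Iio, not_lt] at hlt
    exact hi (by simp only [hf]; rw [hN₁ _ (by omega), hN₂ _ (by omega)]; simp)
  rw [hit] at hlow
  have hterm : ∀ i₀ : ℕ, (∀ i, i ≠ i₀ → f i ∈ G) → f i₀ ∈ G := by
    intro i₀ hi
    rw [finsum_eq_sum _ hfin] at hlow
    by_cases hmem : i₀ ∈ hfin.toFinset
    · rw [← Finset.add_sum_erase _ _ hmem] at hlow
      refine (G.add_mem_iff_left (G.sum_mem fun i hi' => ?_)).1 hlow
      exact hi i (Finset.ne_of_mem_erase hi')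
    · have : f i₀ = 0 := by simpa using hmem
      rw [this]; exact G.zero_mem
  rcases lt_or_ge n 0 with hn | hn
  · have h0 := hterm (-1 - n).toNat fun i hi => G.add_mem (hab _ _ (by ring) (by omega))
      (hba _ _ (by ring) (by omega))
    have e : (((-1 - n).toNat : ℕ) : ℤ) = -1 - n := by omega
    simp only [hf, e] at h0
    rw [G.add_mem_iff_left (hba _ _ (by ring) (by omega))] at h0
    convert h0 using 3 <;> ring_nf
  · have h0 := hterm n.toNat fun i hi => G.add_mem (hab _ _ (by ring) (by omega))
      (hba _ _ (by ring) (by omega))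
    have e : ((n.toNat : ℕ) : ℤ) = n := by omega
    simp only [hf, e] at h0
    rw [G.add_mem_iff_right (hab _ _ (by ring) (by omega))] at h0
    refine hsw ?_
    convert h0 using 2; ring_nf

/-- Words in a fixed finite alphabet reduce to words with distinct small indices. -/
lemma alphabet (hG : W.LowerWordsIn Mod w G N k d) {U : Finset (ℕ × V)}
    (hU : ∀ p ∈ U, p.2 ∈ W.grading p.1) {T : ℤ}
    (hT : ∀ p ∈ U, ∀ n, T ≤ n → Mod.mmode p.2 n w = 0)
    (hgood : ∀ L : List ((ℕ × V) × ℤ), (∀ a ∈ L, a.1 ∈ U ∧ a.2 < T) →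
      (L.map Prod.snd).Nodup → wordDeg L = d → wordOp Mod L w ∈ G) (B : ℕ) :
    ∀ L : List ((ℕ × V) × ℤ), (∀ a ∈ L, a.1 ∈ U) → wordDeg L = d → wordWt L = N →
      L.length = k →
      (L.map fun a => T - a.2).sum ^ 2 - (L.map fun a => (T - a.2) ^ 2).sum < B →
      wordOp Mod L w ∈ G := by
  have hlarge : ∀ L : List ((ℕ × V) × ℤ), (∀ a ∈ L, a.1 ∈ U) → wordDeg L = d → wordWt L = N →
      (∃ a ∈ L, T ≤ a.2) → wordOp Mod L w ∈ G := by
    rintro L hLU hd hN ⟨a, ha, haT⟩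
    obtain ⟨s, t, rfl⟩ := List.append_of_mem ha
    refine hG.mem_of_perm (l' := s ++ t ++ [a]) ?_ (fun b hb => hU _ (hLU b hb)) hd hN ?_
    · exact List.perm_middle.trans (List.perm_append_singleton a (s ++ t)).symm
    · rw [wordOp_append, wordOp_cons, wordOp_nil, hT _ (hLU a ha) _ haT, map_zero]
      exact G.zero_mem
  induction B with
  | zero =>
    intro L hLU hd hN hk hB
    by_cases hex : ∃ a ∈ L, T ≤ a.2
    · exact hlarge L hLU hd hN hex
    · push Not at hex
      have := (List.sum_sq_le_sq_sum (fun a : (ℕ × V) × ℤ => T - a.2) L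
        fun a ha => by have := hex a ha; omega).2
      push_cast at hB
      linarith
  | succ B ih =>
    intro L hLU hd hN hk hB
    by_cases hex : ∃ a ∈ L, T ≤ a.2
    · exact hlarge L hLU hd hN hex
    push Not at hex
    by_cases hnd : (L.map Prod.snd).Nodup
    · exact hgood L (fun a ha => ⟨hLU a ha, hex a ha⟩) hnd hd
    obtain ⟨⟨a, n⟩, ⟨b, n'⟩, L', hp, rfl⟩ := exists_perm_of_not_nodup_map _ L hnd
    have hLh : W.IsHomWord L := fun b hb => hU _ (hLU b hb)
    refine hG.mem_of_perm hp hLh hd hN ?_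
    have hd' := (wordDeg_perm hp).symm.trans hd
    have hN' := (wordWt_perm hp).symm.trans hN
    have hk' := hp.length_eq.symm.trans hk
    have hLU' : ∀ c ∈ (a, n) :: (b, n) :: L', c.1 ∈ U := fun c hc => hLU c (hp.mem_iff.2 hc)
    simp only [List.mem_cons, forall_eq_or_imp] at hLU'
    obtain ⟨haU, hbU, hLU''⟩ := hLU'
    rw [(hp.map _).sum_eq, (hp.map _).sum_eq] at hB
    simp only [List.map_cons, List.sum_cons, Nat.cast_add, Nat.cast_one] at hB
    have step : ∀ a' b' : ℕ × V, a' ∈ U → b' ∈ U → a'.1 + b'.1 = a.1 + b.1 →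
        ∀ s t : ℤ, s + t = 2 * n → s ≠ n → wordOp Mod ((a', s) :: (b', t) :: L') w ∈ G := by
      intro a' b' ha' hb' hab s t hst hs
      refine ih _ ?_ ?_ ?_ (by simpa using hk') ?_
      · simp only [List.mem_cons, forall_eq_or_imp]; exact ⟨ha', hb', hLU''⟩
      · simp only [wordDeg_cons] at hd' ⊢; zify at hab; linarith
      · simp only [wordWt_cons] at hN' ⊢; omega
      · simp only [List.map_cons, List.sum_cons]
        obtain rfl : t = 2 * n - s := by linarith
        have : 1 ≤ (s - n) ^ 2 := by
          have : s - n ≠ 0 := sub_ne_zero.2 hs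
          have := sq_pos_of_ne_zero this
          omega
        rw [show T - s + (T - (2 * n - s) + (L'.map fun a => T - a.2).sum) =
          T - n + (T - n + (L'.map fun a => T - a.2).sum) by ring]
        linarith
    exact hG.repeated (hLh.perm hp) hd' hN' hk' (step a b haU hbU rfl)
      (step b a hbU haU (Nat.add_comm _ _))

end LowerWordsIn

/-- A finite set of homogeneous vectors spans a complement of `C_2(V)` degreewise. -/
def IsAlphabet (W : VOA V) (U : Finset (ℕ × V)) : Prop :=
  (∀ p ∈ U, p.2 ∈ W.grading p.1) ∧ ∀ r : ℕ, W.grading r ≤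
    Submodule.span ℂ ({u | (r, u) ∈ U} ∪ {x | ∃ s t : ℤ, s + t + 1 = r ∧
      ∃ y ∈ W.grading s, ∃ z ∈ W.grading t, x = W.mode y (-2) z})

lemma wordOp_mem_of_good {M : Type} [AddCommGroup M] [Module ℂ M]
    {Mod : WeakMod V W.toVertexAlg M} {w : M} {G : Submodule ℂ M} {d : ℤ} {U : Finset (ℕ × V)}
    (hU : W.IsAlphabet U) {T : ℤ}
    (hT : ∀ p ∈ U, ∀ n, T ≤ n → Mod.mmode p.2 n w = 0)
    (hgood : ∀ L : List ((ℕ × V) × ℤ), (∀ a ∈ L, a.1 ∈ U ∧ a.2 < T) →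
      (L.map Prod.snd).Nodup → wordDeg L = d → wordOp Mod L w ∈ G) (N : ℕ) :
    ∀ (k : ℕ) (L : List ((ℕ × V) × ℤ)), W.IsHomWord L → wordDeg L = d → wordWt L = N →
      L.length = k → wordOp Mod L w ∈ G := by
  induction N using Nat.strong_induction_on with
  | _ N ihN =>
  intro k
  induction k using Nat.strong_induction_on with
  | _ k ihk =>
  have hG : W.LowerWordsIn Mod w G N k d := by
    rintro L hh hd (hlt | ⟨rfl, hlt⟩)
    · exact ihN _ hlt _ L hh hd rfl rfl
    · exact ihk _ hlt L hh hd rfl rfl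
  suffices key : ∀ L₂ L₁ : List ((ℕ × V) × ℤ), (∀ a ∈ L₁, a.1 ∈ U) → W.IsHomWord L₂ →
      wordDeg (L₁ ++ L₂) = d → wordWt (L₁ ++ L₂) = N → (L₁ ++ L₂).length = k →
      wordOp Mod (L₁ ++ L₂) w ∈ G from
    fun L hh hd hN hk => key L [] (by simp) hh hd hN hk
  intro L₂
  induction L₂ with
  | nil =>
    intro L₁ h₁ _ hd hN hk
    rw [List.append_nil] at hd hN hk ⊢
    exact hG.alphabet hU.1 hT hgood _ L₁ h₁ hd hN hk
      ((Int.self_le_toNat _).trans_lt (Int.ofNat_lt.2 (Nat.lt_succ_self _)))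
  | cons a L₂ ih =>
    intro L₁ h₁ h₂ hd hN hk
    obtain ⟨⟨r, x⟩, n⟩ := a
    obtain ⟨hx, h₂'⟩ := isHomWord_cons.1 h₂
    clear h₂
    have h₁' : W.IsHomWord L₁ := fun b hb => hU.1 _ (h₁ b hb)
    have hx' := hU.2 r hx
    simp only [wordDeg_append, wordDeg_cons] at hd
    simp only [wordWt_append, wordWt_cons] at hN
    simp only [List.length_append, List.length_cons] at hk
    rw [wordOp_append, wordOp_cons]
    clear hx
    dsimp only at hx' hd hN ⊢
    induction hx' using Submodule.span_induction with
    | mem x hx =>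
      rcases hx with hx | ⟨s, t, hst, y, hy, z, hz, rfl⟩
      · have := ih (L₁ ++ [((r, x), n)]) (by
            intro b hb
            rcases List.mem_append.1 hb with hb | hb
            · exact h₁ b hb
            · obtain rfl := List.mem_singleton.1 hb; exact hx) h₂'
          (by simp; linarith) (by simp; linarith) (by simp; linarith)
        simpa using this
      · exact hG.mode_neg_two h₁' h₂' hy hz n (by rw [hst]; linarith)
          (by rw [hst]; push_cast [← hN]; ring)
    | zero => simp
    | add x y _ _ hx hy => simpa using G.add_mem hx hy
    | smul c x _ hx => simpa using G.smul_mem c hx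

lemma exists_isAlphabet (h : FiniteDimensional ℂ (V ⧸ Cspace V W.toVertexAlg 2)) :
    ∃ U, W.IsAlphabet U := by
  classical
  set C := Cspace V W.toVertexAlg 2
  set S : Set V := {v | ∃ r : ℕ, v ∈ W.grading r}
  have htop : Submodule.span ℂ S = ⊤ := by
    rw [eq_top_iff, ← W.internal.submodule_iSup_eq_top]
    refine iSup_le fun n v hv => ?_
    rcases lt_or_ge n 0 with hn | hn
    · rw [eq_zero_of_mem_grading_neg hn hv]; exact Submodule.zero_mem _
    · lift n to ℕ using hn
      exact Submodule.subset_span ⟨n, hv⟩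
  have hfg : (Submodule.span ℂ (C.mkQ '' S)).FG := by
    rw [Submodule.span_image, htop, Submodule.map_top, Submodule.range_mkQ]
    exact Module.finite_def.1 h
  obtain ⟨F, hFS, hF⟩ := (Submodule.fg_span_iff_fg_span_finset_subset _).1 hfg
  choose! v hvS hv using fun f (hf : f ∈ (F : Set (V ⧸ C))) => hFS hf
  choose! r hr using hvS
  set U : Finset (ℕ × V) := F.image fun f => (r f, v f) with hUdef
  have hU : ∀ p ∈ U, p.2 ∈ W.grading p.1 := by
    intro p hp
    obtain ⟨f, hf, rfl⟩ := Finset.mem_image.1 hp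
    exact hr f hf
  set D : ℤ → Submodule ℂ V := fun n => Submodule.span ℂ
    ({u | ∃ k : ℕ, (k : ℤ) = n ∧ (k, u) ∈ U} ∪ {x | ∃ s t : ℤ, s + t + 1 = n ∧
      ∃ y ∈ W.grading s, ∃ z ∈ W.grading t, x = W.mode y (-2) z}) with hD
  have hDle : ∀ n, D n ≤ W.grading n := by
    refine fun n => Submodule.span_le.2 ?_
    rintro x (⟨k, rfl, hk⟩ | ⟨s, t, rfl, y, hy, z, hz, rfl⟩)
    · exact hU _ hk
    · have := W.mode_mem_grading hy hz (-2)
      rwa [show s + t - -2 - 1 = s + t + 1 by ring] at this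
  have hCD : C ≤ ⨆ n, D n := by
    refine Submodule.span_le.2 ?_
    rintro _ ⟨y, z, rfl⟩
    have hy : y ∈ ⨆ n, W.grading n := by rw [W.internal.submodule_iSup_eq_top]; trivial
    have hz : z ∈ ⨆ n, W.grading n := by rw [W.internal.submodule_iSup_eq_top]; trivial
    induction hy using Submodule.iSup_induction' with
    | mem s y hy =>
      induction hz using Submodule.iSup_induction' with
      | mem t z hz =>
        exact Submodule.mem_iSup_of_mem (s + t + 1)
          (Submodule.subset_span (Or.inr ⟨s, t, rfl, y, hy, z, hz, rfl⟩))
      | zero => simp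
      | add z z' _ _ h1 h2 => rw [map_add]; exact add_mem h1 h2
    | zero => simp
    | add y y' _ _ h1 h2 =>
      rw [map_add, Pi.add_apply, LinearMap.add_apply]; exact add_mem h1 h2
  have hDtop : ⨆ n, D n = ⊤ := by
    rw [eq_top_iff]
    intro x _
    have hx : C.mkQ x ∈ Submodule.map C.mkQ (⨆ n, D n) := by
      have h1 : C.mkQ x ∈ Submodule.span ℂ (F : Set (V ⧸ C)) := by
        rw [← hF, Submodule.span_image, htop]
        exact ⟨x, trivial, rfl⟩
      refine Submodule.span_le.2 (fun f hf => ?_) h1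
      exact ⟨v f, Submodule.mem_iSup_of_mem (r f : ℤ) (Submodule.subset_span
        (Or.inl ⟨r f, rfl, Finset.mem_image_of_mem _ hf⟩)), hv f hf⟩
    have hx' : x ∈ Submodule.comap C.mkQ (Submodule.map C.mkQ (⨆ n, D n)) := hx
    rw [Submodule.comap_map_mkQ] at hx'
    exact sup_le hCD le_rfl hx'
  refine ⟨U, hU, fun n => ?_⟩
  have := eq_of_le_of_iSupIndep W.internal.submodule_iSupIndep hDle (by rw [hDtop]; exact le_top) n
  rw [← this]
  refine Submodule.span_mono (Set.union_subset_union_left _ ?_)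
  rintro u ⟨k, hk, hku⟩
  obtain rfl : k = n := by exact_mod_cast hk
  exact hku

end VOA

lemma wordDeg_bound {X : Type} {T : ℤ} {L : List ((ℕ × X) × ℤ)} (hT : ∀ a ∈ L, a.2 < T)
    (hL : (L.map Prod.snd).Nodup) :
    0 ≤ wordDeg L + ∑ n ∈ Finset.Ico 0 T, ((n + 1).toNat : ℤ) ∧
      ∀ a ∈ L, -a.2 - 1 ≤ wordDeg L + ∑ n ∈ Finset.Ico 0 T, ((n + 1).toNat : ℤ) := by
  classical
  have h1 : (L.map fun a => ((a.2 + 1).toNat : ℤ)).sum ≤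
      ∑ n ∈ Finset.Ico 0 T, ((n + 1).toNat : ℤ) := by
    have h2 : (L.map fun a => (a.2 + 1).toNat) =
        (L.map Prod.snd).map fun n : ℤ => (n + 1).toNat := by simp
    have h3 : (L.map fun a => (a.2 + 1).toNat).sum ≤ ∑ n ∈ Finset.Ico 0 T, (n + 1).toNat := by
      rw [h2, ← List.sum_toFinset _ hL]
      refine Finset.sum_le_sum_of_ne_zero fun n hn h0 => ?_
      obtain ⟨a, ha, rfl⟩ := List.mem_map.1 (List.mem_toFinset.1 hn)
      have := hT a ha
      rw [Finset.mem_Ico]; omega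
    have h4 : (L.map fun a => ((a.2 + 1).toNat : ℤ)).sum =
        ((L.map fun a => (a.2 + 1).toNat).sum : ℕ) := by
      rw [Nat.cast_list_sum, List.map_map]; rfl
    rw [h4]; exact_mod_cast h3
  have h5 : (L.map fun a => ((a.1.1 : ℤ) - a.2 - 1) + ((a.2 + 1).toNat : ℤ)).sum =
      wordDeg L + (L.map fun a => ((a.2 + 1).toNat : ℤ)).sum := by
    rw [List.sum_map_add]; rfl
  have h6 : ∀ x ∈ L.map fun a => ((a.1.1 : ℤ) - a.2 - 1) + ((a.2 + 1).toNat : ℤ), 0 ≤ x := by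
    intro x hx
    obtain ⟨a, ha, rfl⟩ := List.mem_map.1 hx
    omega
  refine ⟨by linarith [List.sum_nonneg h6], fun a ha => ?_⟩
  have h7 := List.single_le_sum h6 _ (List.mem_map_of_mem ha)
  have h8 : (0 : ℤ) ≤ a.1.1 := Int.natCast_nonneg _
  have h9 : (0 : ℤ) ≤ ((a.2 + 1).toNat : ℤ) := Int.natCast_nonneg _
  linarith

lemma finite_lists_nodup {α : Type*} (s : Finset α) :
    {L : List α | L.Nodup ∧ ∀ a ∈ L, a ∈ s}.Finite := by
  classical
  refine (Set.finite_range fun l : {l : List s // l.Nodup} => l.1.map Subtype.val).subset ?_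
  rintro L ⟨hL, hs⟩
  lift L to List s using hs
  exact ⟨⟨L, hL.of_map _⟩, rfl⟩

section

variable {W : VOA V} {M : Type} [AddCommGroup M] [Module ℂ M] (Mod : WeakMod V W.toVertexAlg M)

/-- Compatibility of a family of subspaces with the grading of `V`. -/
def IsCompatible (g : ℤ → Submodule ℂ M) : Prop :=
  ∀ (r : ℤ) (v : V), v ∈ W.grading r → ∀ (m n : ℤ), ∀ w ∈ g n,
    Mod.mmode v m w ∈ g (n + r - m - 1)

/-- A minimal nonzero invariant subspace. -/
def IsSimpleSub (N : Submodule ℂ M) : Prop :=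
  Invariant V Mod N ∧ N ≠ ⊥ ∧
    ∀ P : Submodule ℂ M, P ≤ N → Invariant V Mod P → P = ⊥ ∨ P = N

variable {Mod}

lemma Invariant.isCompatible {N : Submodule ℂ M} (hN : Invariant V Mod N) :
    IsCompatible Mod fun _ => N := fun _ v _ m _ w hw => hN v m w hw

lemma IsCompatible.inf {g g' : ℤ → Submodule ℂ M} (h : IsCompatible Mod g)
    (h' : IsCompatible Mod g') : IsCompatible Mod fun n => g n ⊓ g' n :=
  fun r v hv m n w hw => ⟨h r v hv m n w hw.1, h' r v hv m n w hw.2⟩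

lemma isCompatible_eigenspace (μ : ℂ) :
    IsCompatible Mod fun n => Module.End.eigenspace (Mod.mmode W.ω 1) (μ + n) := by
  intro r v hv m n w hw
  have := W.mmode_mem_eigenspace Mod hv m hw
  convert this using 2
  push_cast; ring

lemma isCompatible_maxGenEigenspace (μ : ℂ) :
    IsCompatible Mod fun n => Module.End.maxGenEigenspace (Mod.mmode W.ω 1) (μ + n) := by
  intro r v hv m n w hw
  have := W.mmode_mem_maxGenEigenspace Mod hv m hw
  convert this using 2
  push_cast; ring

lemma IsCompatible.invariant_iSup {g : ℤ → Submodule ℂ M} (hg : IsCompatible Mod g) :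
    Invariant V Mod (⨆ n, g n) := by
  intro v m w hw
  have hv : v ∈ ⨆ n, W.grading n := by rw [W.internal.submodule_iSup_eq_top]; trivial
  induction hv using Submodule.iSup_induction' with
  | mem r v hv =>
    induction hw using Submodule.iSup_induction' with
    | mem n w hw => exact Submodule.mem_iSup_of_mem _ (hg r v hv m n w hw)
    | zero => simp
    | add x y _ _ h1 h2 => rw [map_add]; exact add_mem h1 h2
  | zero => simp
  | add x y _ _ h1 h2 => rw [map_add, Pi.add_apply, LinearMap.add_apply]; exact add_mem h1 h2

lemma IsCompatible.L0_mem {g : ℤ → Submodule ℂ M} (hg : IsCompatible Mod g) {n : ℤ} {x : M}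
    (hx : x ∈ g n) : Mod.mmode W.ω 1 x ∈ g n := by
  have := hg 2 W.ω W.ω_grade 1 n x hx
  rwa [show n + 2 - 1 - 1 = n by ring] at this

lemma IsCompatible.wordOp_mem {g : ℤ → Submodule ℂ M} (hg : IsCompatible Mod g) {w : M}
    (hw : w ∈ g 0) {L : List ((ℕ × V) × ℤ)} (hL : W.IsHomWord L) :
    wordOp Mod L w ∈ g (wordDeg L) := by
  induction L with
  | nil => simpa using hw
  | cons a L ih =>
    obtain ⟨ha, hL⟩ := VOA.isHomWord_cons.1 hL
    have := hg _ _ ha a.2 _ _ (ih hL)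
    rw [wordOp_cons, wordDeg_cons]
    convert this using 2
    ring

/-- The degreewise span of the words applied to a vector. -/
def wordSpan (Mod : WeakMod V W.toVertexAlg M) (w : M) (d : ℤ) : Submodule ℂ M :=
  Submodule.span ℂ {x | ∃ L, W.IsHomWord L ∧ wordDeg L = d ∧ x = wordOp Mod L w}

lemma mem_wordSpan (w : M) : w ∈ wordSpan Mod w 0 :=
  Submodule.subset_span ⟨[], by simp [VOA.IsHomWord], rfl, rfl⟩

lemma isCompatible_wordSpan (w : M) : IsCompatible Mod (wordSpan Mod w) := by
  intro r v hv m n x hx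
  rcases lt_or_ge r 0 with hr | hr
  · simp [VOA.eq_zero_of_mem_grading_neg hr hv]
  lift r to ℕ using hr
  suffices wordSpan Mod w n ≤ (wordSpan Mod w (n + r - m - 1)).comap (Mod.mmode v m) from this hx
  refine Submodule.span_le.2 ?_
  rintro _ ⟨L, hL, rfl, rfl⟩
  exact Submodule.subset_span ⟨((r, v), m) :: L, VOA.isHomWord_cons.2 ⟨hv, hL⟩,
    by rw [wordDeg_cons]; ring, by simp⟩

lemma wordSpan_le {w : M} {g : ℤ → Submodule ℂ M} (hg : IsCompatible Mod g) (hw : w ∈ g 0)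
    (d : ℤ) : wordSpan Mod w d ≤ g d := by
  refine Submodule.span_le.2 ?_
  rintro _ ⟨L, hL, rfl, rfl⟩
  exact hg.wordOp_mem hw hL

/-- Over a `C_2`-cofinite vertex operator algebra, cyclic weak modules have finite-dimensional
degree pieces, vanishing in sufficiently negative degrees. -/
lemma wordSpan_finite (h : FiniteDimensional ℂ (V ⧸ Cspace V W.toVertexAlg 2)) (w : M) :
    (∀ d, FiniteDimensional ℂ (wordSpan Mod w d)) ∧ ∃ B, ∀ d < B, wordSpan Mod w d = ⊥ := by
  classical
  obtain ⟨U, hU⟩ := VOA.exists_isAlphabet h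
  obtain ⟨T, hT⟩ : ∃ T : ℤ, ∀ p ∈ U, ∀ n, T ≤ n → Mod.mmode p.2 n w = 0 := by
    choose N hN using fun p : ℕ × V => Mod.trunc p.2 w
    obtain ⟨T, hT⟩ := (U.image N).exists_le
    exact ⟨T, fun p hp n hn => hN p n ((hT _ (Finset.mem_image_of_mem N hp)).trans hn)⟩
  set good : ℤ → Set (List ((ℕ × V) × ℤ)) := fun d =>
    {L | (∀ a ∈ L, a.1 ∈ U ∧ a.2 < T) ∧ (L.map Prod.snd).Nodup ∧ wordDeg L = d}
  have hle : ∀ d, wordSpan Mod w d ≤ Submodule.span ℂ ((fun L => wordOp Mod L w) '' good d) := by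
    refine fun d => Submodule.span_le.2 ?_
    rintro _ ⟨L, hL, hd, rfl⟩
    exact VOA.wordOp_mem_of_good hU hT (fun L' h1 h2 h3 =>
      Submodule.subset_span (Set.mem_image_of_mem (fun L => wordOp Mod L w)
        (show L' ∈ good d from ⟨h1, h2, h3⟩))) _ _ L hL hd rfl rfl
  set B : ℤ := ∑ n ∈ Finset.Ico 0 T, ((n + 1).toNat : ℤ)
  have hbound : ∀ d, ∀ L ∈ good d, 0 ≤ d + B ∧ ∀ a ∈ L, -a.2 - 1 ≤ d + B := by
    rintro d L ⟨h1, h2, rfl⟩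
    exact wordDeg_bound (fun a ha => (h1 a ha).2) h2
  refine ⟨fun d => ?_, -B, fun d hd => ?_⟩
  · have hfin : (good d).Finite := by
      refine (finite_lists_nodup (U ×ˢ Finset.Ico (-d - B - 1) T)).subset fun L hL => ?_
      refine ⟨hL.2.1.of_map _, fun a ha => ?_⟩
      have h1 := hL.1 a ha
      have h2 := (hbound d L hL).2 a ha
      rw [Finset.mem_product, Finset.mem_Ico]
      exact ⟨h1.1, by linarith, h1.2⟩
    have := FiniteDimensional.span_of_finite ℂ (hfin.image fun L => wordOp Mod L w)
    exact Submodule.finiteDimensional_of_le (hle d)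
  · have he : good d = ∅ := by
      refine Set.eq_empty_of_forall_notMem fun L hL => ?_
      have := (hbound d L hL).1
      linarith
    have := hle d
    rw [he, Set.image_empty, Submodule.span_empty] at this
    exact le_bot_iff.1 this

lemma IsSimpleSub.iSup_eq {N : Submodule ℂ M} (hN : IsSimpleSub Mod N) {g : ℤ → Submodule ℂ M}
    (hg : IsCompatible Mod g) (hgN : ∀ n, g n ≤ N) {w : M} {n : ℤ} (hw : w ∈ g n) (hw0 : w ≠ 0) :
    ⨆ n, g n = N := by
  refine (hN.2.2 _ (iSup_le hgN) hg.invariant_iSup).resolve_left fun hb => hw0 ?_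
  have : w ∈ ⨆ n, g n := Submodule.mem_iSup_of_mem n hw
  rw [hb] at this
  simpa using this

/-- Irreducible weak modules over a `C_2`-cofinite vertex operator algebra are ordinary. -/
lemma IsSimpleSub.isSimpleOrdinarySub (h : FiniteDimensional ℂ (V ⧸ Cspace V W.toVertexAlg 2))
    {N : Submodule ℂ M} (hN : IsSimpleSub Mod N) : IsSimpleOrdinarySub V W Mod N := by
  classical
  obtain ⟨x, hxN, hx0⟩ := N.ne_bot_iff.1 hN.2.1
  have hc := isCompatible_wordSpan (Mod := Mod) x
  obtain ⟨μ, w, hwN, hw, hw0⟩ : ∃ (μ : ℂ) (w : M), w ∈ N ∧ Mod.mmode W.ω 1 w = μ • w ∧ w ≠ 0 := by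
    have hfd := (wordSpan_finite (Mod := Mod) h x).1 0
    have hx := mem_wordSpan (Mod := Mod) x
    have : Nontrivial (wordSpan Mod x 0) := ⟨⟨⟨x, hx⟩, 0, fun he => hx0 (congrArg Subtype.val he)⟩⟩
    obtain ⟨μ, hμ⟩ := Module.End.exists_eigenvalue
      ((Mod.mmode W.ω 1).restrict fun y (hy : y ∈ wordSpan Mod x 0) => hc.L0_mem hy)
    obtain ⟨y, hy⟩ := hμ.exists_hasEigenvector
    refine ⟨μ, y, wordSpan_le hN.1.isCompatible hxN 0 y.2, ?_, fun h0 => hy.2 (Subtype.ext h0)⟩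
    exact congrArg Subtype.val hy.apply_eq_smul
  obtain ⟨hfd, B, hB⟩ := wordSpan_finite (Mod := Mod) h w
  set f := Mod.mmode W.ω 1
  set G := wordSpan Mod w with hGdef
  have hGc : IsCompatible Mod G := isCompatible_wordSpan w
  have hGle : ∀ n, G n ≤ f.eigenspace (μ + n) ⊓ N :=
    wordSpan_le ((isCompatible_eigenspace μ).inf hN.1.isCompatible)
      ⟨Module.End.mem_eigenspace_iff.2 (by simpa using hw), hwN⟩
  have hGsup : ⨆ n, G n = N := hN.iSup_eq hGc (fun n => (hGle n).trans inf_le_right)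
    (mem_wordSpan w) hw0
  have hE : ∀ ν, (⨆ (d : ℤ) (_ : μ + d = ν), G d) = f.eigenspace ν ⊓ N := by
    refine eq_of_le_of_iSupIndep (f.eigenspaces_iSupIndep.mono fun _ => inf_le_left) ?_ ?_
    · intro ν
      refine iSup₂_le fun d hd => ?_
      subst hd; exact hGle d
    · refine (iSup_le fun ν => inf_le_right).trans (hGsup.ge.trans (iSup_le fun d => ?_))
      exact le_iSup_of_le (μ + d) (le_iSup₂_of_le d rfl le_rfl)
  have hEd : ∀ d : ℤ, f.eigenspace (μ + d) ⊓ N = G d := by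
    intro d
    rw [← hE]
    refine le_antisymm (iSup₂_le fun e he => ?_) (le_iSup₂_of_le d rfl le_rfl)
    obtain rfl : e = d := by simpa using he
    exact le_rfl
  have hEn : ∀ ν, (∀ d : ℤ, μ + d ≠ ν) → f.eigenspace ν ⊓ N = ⊥ := by
    intro ν hν
    rw [← hE]
    simp [hν]
  refine ⟨hN.1, hN.2.1, hN.2.2, ?_, fun ν => ?_, fun ν => ?_⟩
  · refine le_antisymm (iSup_le fun ν => inf_le_right) (hGsup.ge.trans (iSup_le fun d => ?_))
    exact (hGle d).trans (le_iSup (fun ν => f.eigenspace ν ⊓ N) (μ + d))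
  · by_cases hν : ∃ d : ℤ, μ + d = ν
    · obtain ⟨d, rfl⟩ := hν
      rw [hEd]; exact hfd d
    · push Not at hν
      rw [hEn ν hν]; infer_instance
  · by_cases hν : ∃ d : ℤ, μ + d = ν
    · obtain ⟨d, rfl⟩ := hν
      refine ⟨B - d - 1, fun n hn => ?_⟩
      rw [add_assoc, ← Int.cast_add, hEd]
      exact hB _ (by linarith)
    · push Not at hν
      refine ⟨0, fun n _ => hEn _ fun d hd => hν (d - n) ?_⟩
      push_cast
      linear_combination hd

/-- Irreducible ordinary modules are `ℕ`-gradable. -/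
lemma IsSimpleOrdinarySub.isSimpleGradableSub {N : Submodule ℂ M}
    (hN : IsSimpleOrdinarySub V W Mod N) : IsSimpleGradableSub V W Mod N := by
  obtain ⟨hinv, hne, hmin, hsup, -, hbd⟩ := hN
  have hs : IsSimpleSub Mod N := ⟨hinv, hne, hmin⟩
  obtain ⟨μ, hμ⟩ : ∃ μ, Module.End.eigenspace (Mod.mmode W.ω 1) μ ⊓ N ≠ ⊥ := by
    by_contra! hcon
    rw [← hsup] at hne
    exact hne (by simp [hcon])
  obtain ⟨w, hw, hw0⟩ := Submodule.ne_bot_iff _ |>.1 hμ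
  obtain ⟨b, hb⟩ := hbd μ
  have hc := (isCompatible_eigenspace (Mod := Mod) μ).inf hinv.isCompatible
  have hN' := hs.iSup_eq hc (fun n => inf_le_right) (w := w) (n := 0) (by simpa using hw) hw0
  refine ⟨hinv, hne, hmin,
    fun n => Module.End.eigenspace (Mod.mmode W.ω 1) (μ + (n + b : ℤ)) ⊓ N,
    fun n => inf_le_right, fun n hn => hb _ (by linarith), ?_, ?_, ?_⟩
  · exact ((VOA.iSupIndep_eigenspace_int (Mod.mmode W.ω 1) μ).comp
      (add_left_injective b)).mono fun _ => inf_le_left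
  · refine Eq.trans ?_ hN'
    exact (Equiv.addRight b).iSup_comp
      (g := fun n : ℤ => Module.End.eigenspace (Mod.mmode W.ω 1) (μ + n) ⊓ N)
  · intro r v hv m n x hx
    have := hc r v hv m (n + b) x hx
    rwa [show n + b + r - m - 1 = n + r - m - 1 + b by ring] at this

end

/-- The restriction of a weak module to an invariant subspace. -/
def WeakMod.restrict {A : VertexAlg V} {M : Type} [AddCommGroup M] [Module ℂ M]
    (Mod : WeakMod V A M) {N : Submodule ℂ M} (hN : Invariant V Mod N) : WeakMod V A N where
  mmode :=
    { toFun := fun v n => (Mod.mmode v n).restrict (hN v n)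
      map_add' := fun u v => by
        ext n x; simp [LinearMap.restrict_apply]
      map_smul' := fun c v => by
        ext n x; simp [LinearMap.restrict_apply] }
  trunc := fun v w => by
    obtain ⟨T, hT⟩ := Mod.trunc v w
    exact ⟨T, fun n hn => Subtype.ext (hT n hn)⟩
  vac_mode := fun n w => Subtype.ext <| by
    refine (Mod.vac_mode n w).trans ?_
    split_ifs <;> rfl
  borcherds := fun u v w p q m => Subtype.ext <| by
    have hc : ∀ f : ℕ → N, ((∑ᶠ i, f i : N) : M) = ∑ᶠ i, (f i : M) := fun f =>
      N.subtype.toAddMonoidHom.map_finsum_of_injective Subtype.val_injective f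
    rw [hc, hc]
    exact Mod.borcherds u v w p q m

section

variable {W : VOA V} {M : Type} [AddCommGroup M] [Module ℂ M] {Mod : WeakMod V W.toVertexAlg M}

lemma IsSimpleSub.map_subtype {N : Submodule ℂ M} (hN : Invariant V Mod N) {S : Submodule ℂ N}
    (hS : IsSimpleSub (Mod.restrict hN) S) : IsSimpleSub Mod (S.map N.subtype) := by
  obtain ⟨hinv, hne, hmin⟩ := hS
  refine ⟨?_, ?_, ?_⟩
  · rintro v n _ ⟨x, hx, rfl⟩
    exact ⟨_, hinv v n x hx, rfl⟩
  · intro h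
    exact hne (Submodule.map_injective_of_injective N.injective_subtype
      (h.trans (Submodule.map_bot _).symm))
  · intro P hP hPinv
    have hPN : P ≤ N := hP.trans (Submodule.map_subtype_le N S)
    have hmap : (P.comap N.subtype).map N.subtype = P := by
      rw [Submodule.map_comap_subtype, inf_eq_right.2 hPN]
    have hle : P.comap N.subtype ≤ S := by
      intro x hx
      obtain ⟨y, hy, hyx⟩ := hP hx
      rwa [← Subtype.ext hyx]
    rcases hmin (P.comap N.subtype) hle (fun v n x hx => hPinv v n x hx) with h | h
    · left; rw [← hmap, h, Submodule.map_bot]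
    · right; rw [← hmap, h]

lemma isNGradable_restrict {g : ℤ → Submodule ℂ M} (hg : IsCompatible Mod g)
    (hi : iSupIndep g) {B : ℤ} (hB : ∀ n < B, g n = ⊥) :
    IsNGradable V W (Mod.restrict hg.invariant_iSup) := by
  set N := ⨆ n, g n with hNdef
  have hle : ∀ n, g n ≤ N := fun n => le_iSup g n
  refine ⟨fun n => (g (n + B)).comap N.subtype, ?_, ?_, ?_⟩
  · refine DirectSum.isInternal_submodule_of_iSupIndep_of_iSup_eq_top ?_ ?_
    · intro n
      rw [Submodule.disjoint_def]
      intro x hx hx'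
      have hd := Submodule.disjoint_def.1 (hi (n + B)) x hx
      refine Subtype.ext (hd ?_)
      have hx'' : (x : M) ∈ Submodule.map N.subtype
          (⨆ (j) (_ : j ≠ n), (g (j + B)).comap N.subtype) :=
        Submodule.mem_map_of_mem hx'
      simp only [Submodule.map_iSup] at hx''
      refine (iSup₂_le fun j hj => ?_ : _ ≤ ⨆ (j) (_ : j ≠ n + B), g j) hx''
      refine (Submodule.map_comap_le _ _).trans (le_iSup₂_of_le (j + B) ?_ le_rfl)
      simpa using hj
    · refine Submodule.map_injective_of_injective N.injective_subtype ?_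
      rw [Submodule.map_iSup, Submodule.map_top, Submodule.range_subtype]
      refine Eq.trans (iSup_congr fun n => ?_) ((Equiv.addRight B).iSup_comp (g := g))
      rw [Submodule.map_comap_subtype, inf_eq_right.2 (hle _)]
      rfl
  · intro n hn
    dsimp only
    rw [hB _ (by linarith), Submodule.comap_bot, Submodule.ker_subtype]
  · intro r v hv m n x hx
    have := hg r v hv m (n + B) x hx
    rw [show n + B + r - m - 1 = n + r - m - 1 + B by ring] at this
    exact this

/-- A weak module which is a sum of irreducible submodules is a direct sum of such. -/
lemma exists_isInternal_of_sSup_simple (hM : sSup {N | IsSimpleSub Mod N} = ⊤) :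
    ∃ (ι : Type) (_ : DecidableEq ι) (S : ι → Submodule ℂ M), DirectSum.IsInternal S ∧
      ∀ i, IsSimpleSub Mod (S i) := by
  classical
  let A : Subalgebra ℂ (Module.End ℂ M) := Algebra.adjoin ℂ {f | ∃ v n, f = Mod.mmode v n}
  have hA : ∀ (N : Submodule ℂ M), Invariant V Mod N → ∀ a ∈ A, ∀ x ∈ N, a x ∈ N := by
    intro N hN a ha
    induction ha using Algebra.adjoin_induction with
    | mem f hf => obtain ⟨v, n, rfl⟩ := hf; exact hN v n
    | algebraMap c => intro x hx; exact N.smul_mem c hx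
    | add f g _ _ hf hg => intro x hx; exact N.add_mem (hf x hx) (hg x hx)
    | mul f g _ _ hf hg => intro x hx; exact hf _ (hg x hx)
  let lift (N : Submodule ℂ M) (hN : Invariant V Mod N) : Submodule A M :=
    { N with smul_mem' := fun a x hx => hA N hN a a.2 x hx }
  have hinv : ∀ P : Submodule A M, Invariant V Mod (P.restrictScalars ℂ) := fun P v n x hx =>
    P.smul_mem (⟨Mod.mmode v n, Algebra.subset_adjoin ⟨v, n, rfl⟩⟩ : A) hx
  have hatom : ∀ (N : Submodule ℂ M) (hN : IsSimpleSub Mod N), IsSimpleModule A (lift N hN.1) := by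
    intro N hN
    rw [isSimpleModule_iff_isAtom]
    refine ⟨fun h => hN.2.1 ?_, fun P hP => ?_⟩
    · exact congrArg (Submodule.restrictScalars ℂ) h
    · rcases hN.2.2 (P.restrictScalars ℂ) hP.le (hinv P) with h | h
      · exact (Submodule.restrictScalars_eq_bot_iff _ _ _).1 h
      · exact absurd (show P = lift N hN.1 from SetLike.ext fun x => SetLike.ext_iff.1 h x) hP.ne
  have hsimple : ∀ P : Submodule A M, IsSimpleModule A P →
      IsSimpleSub Mod (P.restrictScalars ℂ) := by
    intro P hP
    rw [isSimpleModule_iff_isAtom] at hP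
    refine ⟨hinv P, fun h => hP.1 ((Submodule.restrictScalars_eq_bot_iff _ _ _).1 h),
      fun Q hQ hQinv => ?_⟩
    rcases hP.le_iff.1 (show lift Q hQinv ≤ P from hQ) with h | h
    · exact Or.inl (congrArg (Submodule.restrictScalars ℂ) h)
    · exact Or.inr (congrArg (Submodule.restrictScalars ℂ) h)
  have htop : sSup {P : Submodule A M | IsSimpleModule A P} = ⊤ := by
    rw [← Submodule.restrictScalars_eq_top_iff ℂ, eq_top_iff, ← hM]
    refine sSup_le fun N hN => ?_
    have : lift N hN.1 ≤ sSup {P : Submodule A M | IsSimpleModule A P} := le_sSup (hatom N hN)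
    exact this
  have := IsSemisimpleModule.of_sSup_simples_eq_top htop
  obtain ⟨s, hs, hs', hs''⟩ := IsSemisimpleModule.exists_sSupIndep_sSup_simples_eq_top A M
  refine ⟨s, inferInstance, fun P => (P : Submodule A M).restrictScalars ℂ, ?_,
    fun P => hsimple _ (hs'' _ P.2)⟩
  exact DirectSum.isInternal_submodule_of_iSupIndep_of_iSup_eq_top
    (A := fun P : s => (P : Submodule A M))
    ((sSupIndep_iff _).1 hs) (by rwa [← sSup_eq_iSup'])

/-- If `ℕ`-gradable weak modules are sums of irreducibles, so are all weak modules over a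
`C_2`-cofinite vertex operator algebra. -/
lemma sSup_simple_eq_top (h : FiniteDimensional ℂ (V ⧸ Cspace V W.toVertexAlg 2))
    (hrat : ∀ (M : Type) [AddCommGroup M] [Module ℂ M] (Mod : WeakMod V W.toVertexAlg M),
      IsNGradable V W Mod → sSup {N | IsSimpleSub Mod N} = ⊤) :
    sSup {N | IsSimpleSub Mod N} = ⊤ := by
  set f := Mod.mmode W.ω 1
  have hgen : ∀ μ, f.maxGenEigenspace μ ≤ sSup {N | IsSimpleSub Mod N} := by
    intro μ w hw
    obtain ⟨-, B, hB⟩ := wordSpan_finite (Mod := Mod) h w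
    have hc := isCompatible_wordSpan (Mod := Mod) w
    have hi : iSupIndep (wordSpan Mod w) :=
      (f.independent_maxGenEigenspace.comp (f := fun n : ℤ => μ + (n : ℂ))
        fun a b hab => by simpa using hab).mono
        (wordSpan_le (isCompatible_maxGenEigenspace μ) (by simpa using hw))
    have htop := hrat _ _ (isNGradable_restrict hc hi hB)
    have hwN : w ∈ ⨆ n, wordSpan Mod w n := Submodule.mem_iSup_of_mem 0 (mem_wordSpan w)
    have hle : (⊤ : Submodule ℂ ↥(⨆ n, wordSpan Mod w n)) ≤
        (sSup {N | IsSimpleSub Mod N}).comap (Submodule.subtype _) := by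
      rw [← htop]
      refine sSup_le fun S hS => Submodule.map_le_iff_le_comap.1 (le_sSup ?_)
      exact IsSimpleSub.map_subtype hc.invariant_iSup hS
    exact hle (x := ⟨w, hwN⟩) trivial
  rw [eq_top_iff]
  intro w _
  have hfd := (wordSpan_finite (Mod := Mod) h w).1 0
  have hmaps : ∀ y ∈ wordSpan Mod w 0, f y ∈ wordSpan Mod w 0 :=
    fun y hy => (isCompatible_wordSpan w).L0_mem hy
  have hle : (⊤ : Submodule ℂ (wordSpan Mod w 0)) ≤
      (sSup {N | IsSimpleSub Mod N}).comap (Submodule.subtype _) := by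
    rw [← Module.End.iSup_maxGenEigenspace_eq_top (f.restrict hmaps)]
    refine iSup_le fun μ => ?_
    rw [Module.End.maxGenEigenspace, Module.End.genEigenspace_restrict]
    exact Submodule.comap_mono (hgen μ)
  exact hle (x := ⟨w, mem_wordSpan w⟩) trivial

end

end Helpers

/-- For a `C_2`-cofinite VOA, regularity (every weak module is a direct sum of
irreducible ordinary modules) is equivalent to rationality (every ℕ-gradable
weak module is a direct sum of irreducible ℕ-gradable weak modules). -/
theorem stmt16 (W : VOA V)
    (h : FiniteDimensional ℂ (V ⧸ Cspace V W.toVertexAlg 2)) :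
    (∀ (M : Type) [AddCommGroup M] [Module ℂ M]
        (Mod : WeakMod V W.toVertexAlg M),
      ∃ (ι : Type) (_ : DecidableEq ι) (S : ι → Submodule ℂ M), DirectSum.IsInternal S ∧
        ∀ i : ι, IsSimpleOrdinarySub V W Mod (S i)) ↔
    (∀ (M : Type) [AddCommGroup M] [Module ℂ M]
        (Mod : WeakMod V W.toVertexAlg M), IsNGradable V W Mod →
      ∃ (ι : Type) (_ : DecidableEq ι) (S : ι → Submodule ℂ M), DirectSum.IsInternal S ∧
        ∀ i : ι, IsSimpleGradableSub V W Mod (S i)) := by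
  constructor
  · intro hreg M _ _ Mod _
    obtain ⟨ι, hι, S, hS, hs⟩ := hreg M Mod
    exact ⟨ι, hι, S, hS, fun i => (hs i).isSimpleGradableSub⟩
  · intro hrat M _ _ Mod
    obtain ⟨ι, hι, S, hS, hs⟩ := exists_isInternal_of_sSup_simple (Mod := Mod)
      (sSup_simple_eq_top h fun M' _ _ Mod' hM' => by
        obtain ⟨ι, hι, S, hS, hs⟩ := hrat M' Mod' hM'
        rw [eq_top_iff, ← hS.submodule_iSup_eq_top]
        exact iSup_le fun i => le_sSup ⟨(hs i).1, (hs i).2.1, (hs i).2.2.1⟩)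
    exact ⟨ι, hι, S, hS, fun i => (hs i).isSimpleOrdinarySub h⟩

end VOAPaper
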